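/- Let A be a commutative ring, B a commutative A-algebra, and f₁, f₂, f₃ ∈ B such that f₁ and f₂ are nonzerodivisors modulo (f₃) and B/(f₃, f₁·f₂) is flat as an A-module. Then for every A-module N and every integer i ≥ 1 there are isomorphisms of A-modules Torᵢᴬ(B/(f₃,f₁), N) ≅ Torᵢ₊₁ᴬ(B/(f₃,f₂), N) and Torᵢᴬ(B/(f₃,f₂), N) ≅ Torᵢ₊₁ᴬ(B/(f₃,f₁), N); in particular Torᵢᴬ(B/(f₃,f₁), N) ≅ Torᵢ₊₂ᴬ(B/(f₃,f₁), N) and Torᵢᴬ(B/(f₃,f₂), N) ≅ Torᵢ₊₂ᴬ(B/(f₃,f₂), N) for all i ≥ 1 (2-periodicity of Tor). -/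

import Mathlib

open CategoryTheory

universe u

/-- `f` is a nonzerodivisor modulo the ideal `K` of `B`:
multiplication by `f` is injective on `B ⧸ K`. -/
def IsNonZeroDivisorMod {B : Type u} [CommRing B] (f : B) (K : Ideal B) : Prop :=
  ∀ x : B, f * x ∈ K → x ∈ K

/-- Abbreviation for `Torᵢᴬ(B ⧸ Ideal.span {a, b}, N)`. -/
noncomputable abbrev torQuot (A : Type u) {B : Type u} [CommRing A] [CommRing B]
    [Algebra A B] (a b : B) (N : Type u) [AddCommGroup N] [Module A N] (i : ℕ) :
    ModuleCat.{u} A :=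
  ((Tor (ModuleCat.{u} A) i).obj
    (ModuleCat.of A (B ⧸ Ideal.span ({a, b} : Set B)))).obj (ModuleCat.of A N)

open MonoidalCategory in
/-- Dimension shifting for Tor in the first variable. -/
theorem tor_shift_of_flat_middle {A : Type u} [CommRing A] (S : ShortComplex (ModuleCat.{u} A))
    (hS : S.ShortExact) [Module.Flat A S.X₂] (N : ModuleCat.{u} A) (i : ℕ) (hi : 1 ≤ i) :
    Nonempty (((Tor (ModuleCat.{u} A) i).obj S.X₁).obj N ≅
      ((Tor (ModuleCat.{u} A) (i + 1)).obj S.X₃).obj N) := by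
  let P := projectiveResolution N
  have hzero (n : ℕ) : ((tensoringLeft (ModuleCat.{u} A)).map S.f).app (P.complex.X n) ≫
      ((tensoringLeft (ModuleCat.{u} A)).map S.g).app (P.complex.X n) = 0 := by
    rw [← NatTrans.comp_app, ← Functor.map_comp, S.zero]
    simp
  let T : ShortComplex (ChainComplex (ModuleCat.{u} A) ℕ) :=
    ShortComplex.mk
      ((NatTrans.mapHomologicalComplex ((tensoringLeft (ModuleCat.{u} A)).map S.f) _).app P.complex)
      ((NatTrans.mapHomologicalComplex ((tensoringLeft (ModuleCat.{u} A)).map S.g) _).app P.complex)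
      (by
        ext1 n
        exact hzero n)
  have hT : T.ShortExact := by
    refine HomologicalComplex.shortExact_of_degreewise_shortExact _ fun n => ?_
    have hp : Module.Projective A (P.complex.X n) :=
      (IsProjective.iff_projective (P.complex.X n)).2 (P.projective n)
    exact hS.map_of_exact (tensorRight (P.complex.X n))
  have hz : ∀ j, 1 ≤ j → Limits.IsZero (T.X₂.homology j) := by
    intro j hj
    rw [← HomologicalComplex.exactAt_iff_isZero_homology]
    obtain ⟨k, rfl⟩ := Nat.exists_eq_add_of_le' hj
    have h1 := Module.Flat.lTensor_shortComplex_exact S.X₂ _ (P.complex_exactAt_succ k)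
    rw [HomologicalComplex.exactAt_iff]
    exact h1
  exact ⟨(P.isoLeftDerivedObj _ i) ≪≫
    (hT.δIso (i + 1) i (by simp) (hz _ (by omega)) (hz _ hi)).symm ≪≫
    (P.isoLeftDerivedObj _ (i + 1)).symm⟩

theorem torQuot_shift {A B : Type u} [CommRing A] [CommRing B] [Algebra A B]
    (f₁ f₂ f₃ : B)
    (h₂ : IsNonZeroDivisorMod f₂ (Ideal.span {f₃}))
    (hflat : Module.Flat A (B ⧸ Ideal.span ({f₃, f₁ * f₂} : Set B)))
    (N : Type u) [AddCommGroup N] [Module A N] (i : ℕ) (hi : 1 ≤ i) :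
    Nonempty (torQuot A f₃ f₁ N i ≅ torQuot A f₃ f₂ N (i + 1)) := by
  let φ : (B ⧸ Ideal.span ({f₃, f₁} : Set B)) →ₗ[B] (B ⧸ Ideal.span ({f₃, f₁ * f₂} : Set B)) :=
    Submodule.mapQ _ _ (LinearMap.mulLeft B f₂) (by
      intro x hx
      rw [Ideal.mem_span_pair] at hx
      obtain ⟨a, b, rfl⟩ := hx
      rw [Submodule.mem_comap, LinearMap.mulLeft_apply]
      exact Ideal.mem_span_pair.2 ⟨f₂ * a, b, by ring⟩)
  let ψ : (B ⧸ Ideal.span ({f₃, f₁ * f₂} : Set B)) →ₗ[B] (B ⧸ Ideal.span ({f₃, f₂} : Set B)) :=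
    Submodule.mapQ _ _ LinearMap.id (by
      intro x hx
      rw [Ideal.mem_span_pair] at hx
      obtain ⟨a, b, rfl⟩ := hx
      rw [Submodule.mem_comap, LinearMap.id_apply]
      exact Ideal.mem_span_pair.2 ⟨a, b * f₁, by ring⟩)
  have hφ : ∀ x : B, φ (Submodule.Quotient.mk x) = Submodule.Quotient.mk (f₂ * x) := fun _ => rfl
  have hψ : ∀ x : B, ψ (Submodule.Quotient.mk x) = Submodule.Quotient.mk x := fun _ => rfl
  have hinj : Function.Injective φ := by
    rw [injective_iff_map_eq_zero]
    intro x hx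
    obtain ⟨x, rfl⟩ := Submodule.Quotient.mk_surjective _ x
    rw [hφ, Submodule.Quotient.mk_eq_zero, Ideal.mem_span_pair] at hx
    obtain ⟨a, b, h⟩ := hx
    have hh := h₂ (x - b * f₁) (Ideal.mem_span_singleton'.2 ⟨a, by linear_combination h⟩)
    obtain ⟨c, hc⟩ := Ideal.mem_span_singleton'.1 hh
    rw [Submodule.Quotient.mk_eq_zero]
    exact Ideal.mem_span_pair.2 ⟨c, b, by linear_combination hc⟩
  have hsurj : Function.Surjective ψ := by
    intro x
    obtain ⟨x, rfl⟩ := Submodule.Quotient.mk_surjective _ x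
    exact ⟨Submodule.Quotient.mk x, rfl⟩
  have hex : Function.Exact φ ψ := by
    intro x
    obtain ⟨x, rfl⟩ := Submodule.Quotient.mk_surjective _ x
    rw [hψ, Submodule.Quotient.mk_eq_zero]
    constructor
    · intro h
      obtain ⟨a, b, h⟩ := Ideal.mem_span_pair.1 h
      refine ⟨Submodule.Quotient.mk b, ?_⟩
      rw [hφ, Submodule.Quotient.eq]
      exact Ideal.mem_span_pair.2 ⟨-a, 0, by linear_combination -h⟩
    · rintro ⟨y, hy⟩
      obtain ⟨y, rfl⟩ := Submodule.Quotient.mk_surjective _ y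
      rw [hφ, Submodule.Quotient.eq] at hy
      obtain ⟨a, b, h⟩ := Ideal.mem_span_pair.1 hy
      exact Ideal.mem_span_pair.2 ⟨-a, y - b * f₁, by linear_combination -h⟩
  let S : ShortComplex (ModuleCat.{u} A) :=
    ShortComplex.mk (ModuleCat.ofHom (φ.restrictScalars A)) (ModuleCat.ofHom (ψ.restrictScalars A))
      (ModuleCat.hom_ext (LinearMap.ext fun x => hex.apply_apply_eq_zero x))
  have hS : S.ShortExact :=
    { exact := (ShortComplex.ShortExact.moduleCat_exact_iff_function_exact S).2 hex
      mono_f := (ModuleCat.mono_iff_injective _).2 hinj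
      epi_g := (ModuleCat.epi_iff_surjective _).2 hsurj }
  have : Module.Flat A S.X₂ := hflat
  exact tor_shift_of_flat_middle S hS (ModuleCat.of A N) i hi

/-- If `f₁`, `f₂` are nonzerodivisors modulo `(f₃)` and `B/(f₃, f₁·f₂)` is flat over
`A`, then for every `A`-module `N` and every `i ≥ 1` there are isomorphisms
`Torᵢ(B/(f₃,f₁), N) ≅ Torᵢ₊₁(B/(f₃,f₂), N)` and
`Torᵢ(B/(f₃,f₂), N) ≅ Torᵢ₊₁(B/(f₃,f₁), N)`; in particular the `2`-periodicity
`Torᵢ(B/(f₃,fⱼ), N) ≅ Torᵢ₊₂(B/(f₃,fⱼ), N)` for `j = 1, 2`. -/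
theorem tor_two_periodicity {A B : Type u} [CommRing A] [CommRing B] [Algebra A B]
    (f₁ f₂ f₃ : B)
    (h₁ : IsNonZeroDivisorMod f₁ (Ideal.span {f₃}))
    (h₂ : IsNonZeroDivisorMod f₂ (Ideal.span {f₃}))
    (hflat : Module.Flat A (B ⧸ Ideal.span ({f₃, f₁ * f₂} : Set B)))
    (N : Type u) [AddCommGroup N] [Module A N] (i : ℕ) (hi : 1 ≤ i) :
    Nonempty (torQuot A f₃ f₁ N i ≅ torQuot A f₃ f₂ N (i + 1)) ∧
      Nonempty (torQuot A f₃ f₂ N i ≅ torQuot A f₃ f₁ N (i + 1)) ∧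
      Nonempty (torQuot A f₃ f₁ N i ≅ torQuot A f₃ f₁ N (i + 2)) ∧
      Nonempty (torQuot A f₃ f₂ N i ≅ torQuot A f₃ f₂ N (i + 2)) := by
  have h12 := fun i hi => torQuot_shift f₁ f₂ f₃ h₂ hflat N i hi
  have h21 := fun i hi =>
    torQuot_shift f₂ f₁ f₃ h₁ (by rw [mul_comm f₂ f₁]; exact hflat) N i hi
  obtain ⟨a⟩ := h12 i hi
  obtain ⟨b⟩ := h21 i hi
  obtain ⟨aa⟩ := h12 (i + 1) (by omega)
  obtain ⟨bb⟩ := h21 (i + 1) (by omega)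
  exact ⟨⟨a⟩, ⟨b⟩, ⟨a ≪≫ bb⟩, ⟨b ≪≫ aa⟩⟩
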